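/- arXiv:2004.05995 — 2 statements merged into one kernel-verified Lean document; each statement's English description precedes it below -/
import Mathlib

section
/- Let M ≥ 1 be a real number, let d ∈ ℕ, and let Q ∈ ℝ^{d×d} be a matrix such that the matrix exponential e^{tQ} is column stochastic for every t ∈ [0,∞) and such that ‖e^{-Q}‖ ≤ M. Then ‖Q‖ ≤ 2 |trace(Q)| ≤ 2 d log(M). -/
open scoped Matrix

/-- The linear map `x ↦ A *ᵥ x` as a continuous linear map on `ℝ^d` endowed with
the `1`-norm `‖x‖₁ = ∑ i, |x i|`. -/
noncomputable def Matrix.toL1CLM {d : ℕ} (A : Matrix (Fin d) (Fin d) ℝ) :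
    PiLp 1 (fun _ : Fin d => ℝ) →L[ℝ] PiLp 1 (fun _ : Fin d => ℝ) :=
  LinearMap.toContinuousLinearMap <|
    (WithLp.linearEquiv 1 ℝ (∀ _ : Fin d, ℝ)).symm.toLinearMap ∘ₗ
      A.mulVecLin ∘ₗ (WithLp.linearEquiv 1 ℝ (∀ _ : Fin d, ℝ)).toLinearMap

/-- The operator norm of a square matrix induced by the `1`-norm on `ℝ^d`. -/
noncomputable def Matrix.l1OpNorm {d : ℕ} (A : Matrix (Fin d) (Fin d) ℝ) : ℝ :=
  ‖A.toL1CLM‖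

/-- A square matrix is column stochastic if all its entries are nonnegative and
each of its columns sums to `1`. -/
def Matrix.ColumnStochastic {d : ℕ} (A : Matrix (Fin d) (Fin d) ℝ) : Prop :=
  (∀ i j, 0 ≤ A i j) ∧ ∀ j, ∑ i, A i j = 1

namespace Matrix

open NormedSpace

section Exponential

variable {n : Type*} [Fintype n] [DecidableEq n]

open scoped Norms.Operator in
theorem hasDerivAt_exp_smul_apply (A : Matrix n n ℝ) (t : ℝ) (i j : n) :
    HasDerivAt (fun u : ℝ => exp (u • A) i j) ((exp (t • A) * A) i j) t :=
  (LinearMap.toContinuousLinearMap (entryLinearMap ℝ ℝ i j)).hasFDerivAt.comp_hasDerivAt t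
    (hasDerivAt_exp_smul_const A t)

/-- Jacobi's formula at a point where the matrix is the identity. -/
theorem hasDerivAt_det_of_eq_one {F : ℝ → Matrix n n ℝ} {A : Matrix n n ℝ} {t : ℝ}
    (hF : ∀ i j, HasDerivAt (fun u => F u i j) (A i j) t) (h1 : F t = 1) :
    HasDerivAt (fun u => (F u).det) A.trace t := by
  have key : HasDerivAt
      (fun u => ∑ σ : Equiv.Perm n, ((Equiv.Perm.sign σ : ℤ) : ℝ) * ∏ i, F u (σ i) i)
      (∑ σ : Equiv.Perm n, ((Equiv.Perm.sign σ : ℤ) : ℝ) *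
        ∑ i, (∏ j ∈ Finset.univ.erase i, F t (σ j) j) • A (σ i) i) t :=
    HasDerivAt.fun_sum fun σ _ =>
      (HasDerivAt.fun_finsetProd fun i _ => hF (σ i) i).const_mul _
  simp only [det_apply']
  convert! key using 1
  rw [Finset.sum_eq_single 1]
  · simp [h1, trace]
  · intro σ _ hσ
    rw [Finset.sum_eq_zero, mul_zero]
    intro i _
    have : ∃ j, j ≠ i ∧ σ j ≠ j := by
      by_contra! h
      apply hσ
      ext j
      by_cases hj : j = i
      · subst hj
        by_contra hne
        have := h (σ j) hne
        exact hne (σ.injective this)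
      · exact h j hj
    obtain ⟨j, hji, hj⟩ := this
    rw [Finset.prod_eq_zero (Finset.mem_erase.2 ⟨hji, Finset.mem_univ j⟩), zero_smul]
    rw [h1, one_apply_ne hj]
  · simp

theorem det_exp_eq_exp_trace (A : Matrix n n ℝ) : (exp A).det = Real.exp A.trace := by
  have h0 : HasDerivAt (fun u : ℝ => (exp (u • A)).det) A.trace 0 :=
    hasDerivAt_det_of_eq_one
      (fun i j => by simpa using hasDerivAt_exp_smul_apply A 0 i j) (by simp)
  have hadd (s t : ℝ) : (exp (s • A)).det = (exp (t • A)).det * (exp ((s - t) • A)).det := by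
    rw [← det_mul, ← exp_add_of_commute _ _ (((Commute.refl A).smul_left _).smul_right _),
      ← add_smul, add_sub_cancel]
  have ht (t : ℝ) :
      HasDerivAt (fun u : ℝ => (exp (u • A)).det) ((exp (t • A)).det * A.trace) t := by
    have h0' : HasDerivAt (fun u : ℝ => (exp (u • A)).det) A.trace (t - t) := by rwa [sub_self]
    have := (h0'.comp_sub_const t t).const_mul (exp (t • A)).det
    exact this.congr_of_eventuallyEq (.of_forall fun s => hadd s t)
  have hconst (t : ℝ) :
      HasDerivAt (fun u : ℝ => (exp (u • A)).det * Real.exp (-(u * A.trace))) 0 t := by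
    convert! (ht t).mul ((hasDerivAt_id t).mul_const A.trace).neg.exp using 1
    simp only [Pi.neg_apply, id]
    ring
  have h := is_const_of_deriv_eq_zero (fun t => (hconst t).differentiableAt)
    (fun t => (hconst t).deriv) 1 0
  simp only [one_smul, one_mul, zero_smul, zero_mul, NormedSpace.exp_zero, det_one, neg_zero,
    Real.exp_zero, mul_one, Real.exp_neg] at h
  field_simp at h
  exact h

end Exponential

theorem abs_det_le_prod_sum_abs {n : Type*} [Fintype n] [DecidableEq n] (A : Matrix n n ℝ) :
    |A.det| ≤ ∏ j, ∑ i, |A i j| := by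
  rw [Fintype.prod_sum, det_apply]
  calc _ ≤ ∑ σ : Equiv.Perm n, ∏ j, |A (σ j) j| := by
        refine (Finset.abs_sum_le_sum_abs _ _).trans (Finset.sum_le_sum fun σ _ => ?_)
        rcases Int.units_eq_one_or (Equiv.Perm.sign σ) with h | h <;>
          simp [h, Finset.abs_prod]
    _ = ∑ f ∈ Finset.univ.map ⟨fun σ : Equiv.Perm n => (σ : n → n), DFunLike.coe_injective⟩,
          ∏ j, |A (f j) j| := by simp
    _ ≤ _ := Finset.sum_le_sum_of_subset_of_nonneg (Finset.subset_univ _)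
        fun f _ _ => Finset.prod_nonneg fun j _ => abs_nonneg _

section L1OpNorm

variable {d : ℕ} (A : Matrix (Fin d) (Fin d) ℝ)

theorem toL1CLM_apply (x : PiLp 1 (fun _ : Fin d => ℝ)) (i : Fin d) :
    A.toL1CLM x i = ∑ j, A i j * x j := rfl

theorem sum_abs_le_l1OpNorm (j : Fin d) : ∑ i, |A i j| ≤ A.l1OpNorm := by
  have h := A.toL1CLM.le_opNorm (PiLp.single 1 j 1)
  rw [PiLp.norm_single, PiLp.norm_eq_of_L1] at h
  simpa [toL1CLM_apply, Pi.single_apply, l1OpNorm] using h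

theorem l1OpNorm_le {C : ℝ} (hC : 0 ≤ C) (h : ∀ j, ∑ i, |A i j| ≤ C) : A.l1OpNorm ≤ C := by
  refine A.toL1CLM.opNorm_le_bound hC fun x => ?_
  simp only [PiLp.norm_eq_of_L1, toL1CLM_apply, Real.norm_eq_abs]
  calc ∑ i, |∑ j, A i j * x j| ≤ ∑ i, ∑ j, |A i j| * |x j| := by
        gcongr with i
        simpa only [abs_mul] using Finset.abs_sum_le_sum_abs (fun j => A i j * x j) Finset.univ
    _ = ∑ j, (∑ i, |A i j|) * |x j| := by
        rw [Finset.sum_comm]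
        simp only [Finset.sum_mul]
    _ ≤ ∑ j, C * |x j| := by
        gcongr with j
        exact h j
    _ = C * ∑ j, |x j| := (Finset.mul_sum _ _ _).symm

theorem abs_det_le_l1OpNorm_pow : |A.det| ≤ A.l1OpNorm ^ d :=
  A.abs_det_le_prod_sum_abs.trans <|
    (Finset.prod_le_prod (fun _ _ => Finset.sum_nonneg fun _ _ => abs_nonneg _)
      fun j _ => A.sum_abs_le_l1OpNorm j).trans_eq (by simp)

end L1OpNorm

section Generator

variable {d : ℕ} {Q : Matrix (Fin d) (Fin d) ℝ}

theorem apply_nonneg_of_columnStochastic_exp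
    (hstoch : ∀ t : ℝ, 0 ≤ t → ColumnStochastic (exp (t • Q))) {i j : Fin d} (hij : i ≠ j) :
    0 ≤ Q i j := by
  have h : HasDerivAt (fun u : ℝ => exp (u • Q) i j) (Q i j) 0 := by
    simpa using hasDerivAt_exp_smul_apply Q 0 i j
  have h' := (hasDerivWithinAt_iff_tendsto_slope' Set.self_notMem_Ioi).1
    (h.hasDerivWithinAt (s := Set.Ioi 0))
  refine ge_of_tendsto h' ?_
  filter_upwards [self_mem_nhdsWithin] with t ht
  rw [slope_def_field]
  simp only [zero_smul, NormedSpace.exp_zero, one_apply_ne hij, sub_zero]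
  exact div_nonneg ((hstoch t (le_of_lt ht)).1 i j) (le_of_lt ht)

theorem sum_apply_eq_zero_of_columnStochastic_exp
    (hstoch : ∀ t : ℝ, 0 ≤ t → ColumnStochastic (exp (t • Q))) (j : Fin d) : ∑ i, Q i j = 0 := by
  have h : HasDerivAt (fun u : ℝ => ∑ i, exp (u • Q) i j) (∑ i, Q i j) 0 :=
    HasDerivAt.fun_sum fun i _ => by simpa using hasDerivAt_exp_smul_apply Q 0 i j
  have h1 : HasDerivWithinAt (fun _ : ℝ => (1 : ℝ)) (∑ i, Q i j) (Set.Ici 0) 0 :=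
    h.hasDerivWithinAt.congr (fun t ht => ((hstoch t ht).2 j).symm)
      ((hstoch 0 le_rfl).2 j).symm
  exact (uniqueDiffOn_Ici (0 : ℝ) 0 Set.self_mem_Ici).eq_deriv _ h1 (hasDerivWithinAt_const ..)

theorem sum_erase_of_columnStochastic_exp
    (hstoch : ∀ t : ℝ, 0 ≤ t → ColumnStochastic (exp (t • Q))) (j : Fin d) :
    ∑ i ∈ Finset.univ.erase j, Q i j = -Q j j := by
  have h := Finset.add_sum_erase Finset.univ (fun i => Q i j) (Finset.mem_univ j)
  rw [sum_apply_eq_zero_of_columnStochastic_exp hstoch j] at h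
  linarith

theorem diag_nonpos_of_columnStochastic_exp
    (hstoch : ∀ t : ℝ, 0 ≤ t → ColumnStochastic (exp (t • Q))) (j : Fin d) : Q j j ≤ 0 := by
  have h : 0 ≤ ∑ i ∈ Finset.univ.erase j, Q i j := Finset.sum_nonneg fun i hi =>
    apply_nonneg_of_columnStochastic_exp hstoch (Finset.ne_of_mem_erase hi)
  rw [sum_erase_of_columnStochastic_exp hstoch] at h
  linarith

theorem sum_abs_of_columnStochastic_exp
    (hstoch : ∀ t : ℝ, 0 ≤ t → ColumnStochastic (exp (t • Q))) (j : Fin d) :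
    ∑ i, |Q i j| = 2 * -Q j j := by
  have h : ∑ i ∈ Finset.univ.erase j, |Q i j| = ∑ i ∈ Finset.univ.erase j, Q i j :=
    Finset.sum_congr rfl fun i hi => abs_of_nonneg
      (apply_nonneg_of_columnStochastic_exp hstoch (Finset.ne_of_mem_erase hi))
  rw [← Finset.add_sum_erase Finset.univ _ (Finset.mem_univ j), h,
    sum_erase_of_columnStochastic_exp hstoch,
    abs_of_nonpos (diag_nonpos_of_columnStochastic_exp hstoch j)]
  ring

end Generator

end Matrix

/-- If `Q ∈ ℝ^{d×d}` generates a column stochastic semigroup `(e^{tQ})_{t ≥ 0}` and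
`‖e^{-Q}‖ ≤ M` with `M ≥ 1`, then `‖Q‖ ≤ 2 |trace Q| ≤ 2 d log M` (operator norms
induced by the `1`-norm, `log` the natural logarithm). -/
theorem norm_le_two_abs_trace_le_dim_log {d : ℕ} (M : ℝ) (hM : 1 ≤ M)
    (Q : Matrix (Fin d) (Fin d) ℝ)
    (hstoch : ∀ t : ℝ, 0 ≤ t → Matrix.ColumnStochastic (NormedSpace.exp (t • Q)))
    (hle : Matrix.l1OpNorm (NormedSpace.exp (-Q)) ≤ M) :
    Matrix.l1OpNorm Q ≤ 2 * |Matrix.trace Q| ∧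
      2 * |Matrix.trace Q| ≤ 2 * d * Real.log M := by
  have hdiag := Matrix.diag_nonpos_of_columnStochastic_exp hstoch
  have hneg : Q.trace ≤ 0 := Finset.sum_nonpos fun j _ => hdiag j
  have htrace : |Q.trace| = ∑ j, -Q j j := by
    rw [abs_of_nonpos hneg]
    simp [Matrix.trace]
  constructor
  · refine Q.l1OpNorm_le (by positivity) fun j => ?_
    rw [Matrix.sum_abs_of_columnStochastic_exp hstoch j, htrace]
    gcongr
    exact Finset.single_le_sum (f := fun j => -Q j j)
      (fun k _ => neg_nonneg.2 (hdiag k)) (Finset.mem_univ j)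
  · have hdet : Real.exp |Q.trace| ≤ M ^ d := by
      have h := (NormedSpace.exp (-Q)).abs_det_le_l1OpNorm_pow
      rw [Matrix.det_exp_eq_exp_trace, Real.abs_exp, Matrix.trace_neg] at h
      rw [abs_of_nonpos hneg]
      exact h.trans (pow_le_pow_left₀ (norm_nonneg _) hle d)
    have h := (Real.le_log_iff_exp_le (by positivity)).2 hdet
    rw [Real.log_pow] at h
    linarith
end

section
/- Let E be a real Banach lattice and let Q be a bounded linear operator on E such that the group of operator exponentials (e^{tQ})_{t ∈ ℝ} is uniformly bounded (i.e., sup_{t ∈ ℝ} ‖e^{tQ}‖ < ∞) and such that e^{tQ} is a positive operator for every t ∈ [0,∞). Then Q = 0. (In particular, in the main theorem one can choose C(1) = 0.) -/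
open Filter Topology

theorem norm_le_norm_of_nonneg_of_le {E : Type*} [NormedAddCommGroup E] [Lattice E]
    [HasSolidNorm E] [IsOrderedAddMonoid E] {a b : E} (ha : 0 ≤ a) (hab : a ≤ b) : ‖a‖ ≤ ‖b‖ :=
  norm_le_norm_of_abs_le_abs (by rwa [abs_of_nonneg ha, abs_of_nonneg (ha.trans hab)])

section BanachLattice

variable {E : Type*} [NormedAddCommGroup E] [Lattice E] [IsOrderedAddMonoid E]

theorem inf_add_le_inf_add_inf {a b c : E} (ha : 0 ≤ a) (hb : 0 ≤ b) (hc : 0 ≤ c) :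
    a ⊓ (b + c) ≤ a ⊓ b + a ⊓ c := by
  have h1 : a ⊓ (b + c) - c ≤ a ⊓ b := by
    refine le_inf ?_ ?_
    · exact (sub_le_self _ hc).trans inf_le_left
    · exact sub_le_iff_le_add.2 inf_le_right
  have h2 : a ⊓ (b + c) - a ≤ a ⊓ b :=
    (sub_nonpos.2 inf_le_left).trans (le_inf ha hb)
  have h3 : a ⊓ (b + c) - a ⊓ b ≤ a ⊓ c := le_inf (sub_le_comm.1 h2) (sub_le_comm.1 h1)
  exact sub_le_iff_le_add'.1 h3

variable [NormedSpace ℝ E] [IsOrderedModule ℝ E]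

theorem smul_inf_eq_zero {a b : E} (ha : 0 ≤ a) (hb : 0 ≤ b) (hab : a ⊓ b = 0) {r : ℝ}
    (hr : 0 ≤ r) : (r • a) ⊓ b = 0 := by
  refine le_antisymm ?_ (le_inf (smul_nonneg hr ha) hb)
  have hM : 0 < max r 1 := lt_of_lt_of_le one_pos (le_max_right _ _)
  have hz : 0 ≤ (r • a) ⊓ b := le_inf (smul_nonneg hr ha) hb
  have h : (max r 1)⁻¹ • ((r • a) ⊓ b) ≤ a ⊓ b := by
    refine le_inf ?_ ?_
    · rw [inv_smul_le_iff_of_pos hM]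
      exact inf_le_left.trans (smul_le_smul_of_nonneg_right (le_max_left _ _) ha)
    · rw [inv_smul_le_iff_of_pos hM]
      refine inf_le_right.trans ?_
      simpa using smul_le_smul_of_nonneg_right (le_max_right r 1) hb
  rwa [hab, inv_smul_le_iff_of_pos hM, smul_zero] at h

variable [HasSolidNorm E]

/-- A bounded generator of a positive semigroup is positive off the diagonal. -/
theorem negPart_apply_inf_eq_zero [CompleteSpace E] {Q : E →L[ℝ] E}
    (hpos : ∀ t : ℝ, 0 ≤ t → ∀ x : E, 0 ≤ x → 0 ≤ NormedSpace.exp (t • Q) x)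
    {x y : E} (hx : 0 ≤ x) (hy : 0 ≤ y) (hxy : x ⊓ y = 0) : (Q x)⁻ ⊓ y = 0 := by
  have hnn : 0 ≤ (Q x)⁻ ⊓ y := le_inf (negPart_nonneg _) hy
  have hd : HasDerivAt (fun t : ℝ => NormedSpace.exp (t • Q) x) (Q x) 0 := by
    have h := (hasDerivAt_exp_smul_const Q (0 : ℝ)).clm_apply (hasDerivAt_const (0 : ℝ) x)
    simpa using h
  rw [hasDerivAt_iff_isLittleO_nhds_zero] at hd
  simp only [zero_add, zero_smul, NormedSpace.exp_zero, one_apply_eq_self] at hd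
  rw [← norm_eq_zero]
  refine le_antisymm (le_of_forall_pos_le_add fun ε hε => ?_) (norm_nonneg _)
  have hev := (hd.def hε).filter_mono (nhdsWithin_le_nhds (s := Set.Ioi 0))
  obtain ⟨t, hr, ht0, ht1⟩ := (hev.and (Ioo_mem_nhdsGT (zero_lt_one' ℝ))).exists
  set r := NormedSpace.exp (t • Q) x - x - t • Q x with hrdef
  have hneg : t • (Q x)⁻ ≤ x + |r| := by
    rw [← le_inv_smul_iff_of_pos ht0, negPart_def]
    refine sup_le ?_ (smul_nonneg (inv_nonneg.2 ht0.le) (add_nonneg hx (abs_nonneg _)))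
    rw [le_inv_smul_iff_of_pos ht0, smul_neg, neg_le_iff_add_nonneg]
    have h0 := hpos t ht0.le x hx
    have h1 : NormedSpace.exp (t • Q) x = t • Q x + (x + r) := by rw [hrdef]; abel
    rw [h1] at h0
    refine h0.trans ?_
    rw [add_comm (x + |r|)]
    gcongr
    exact le_abs_self r
  have hle : t • ((Q x)⁻ ⊓ y) ≤ |r| := by
    have h1 : t • ((Q x)⁻ ⊓ y) ≤ y ⊓ (x + |r|) := by
      refine le_inf ?_ ?_
      · refine (smul_le_smul_of_nonneg_left inf_le_right ht0.le).trans ?_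
        simpa using smul_le_smul_of_nonneg_right ht1.le hy
      · exact (smul_le_smul_of_nonneg_left inf_le_left ht0.le).trans hneg
    refine (h1.trans (inf_add_le_inf_add_inf hy hx (abs_nonneg r))).trans ?_
    rw [inf_comm y x, hxy, zero_add]
    exact inf_le_right
  have hn := norm_le_norm_of_nonneg_of_le (smul_nonneg ht0.le hnn) hle
  rw [norm_abs_eq_norm, norm_smul, Real.norm_of_nonneg ht0.le] at hn
  rw [Real.norm_of_nonneg ht0.le] at hr
  rw [zero_add]
  exact le_of_mul_le_mul_left (by linarith) ht0

theorem mul_norm_le_of_disjoint [CompleteSpace E] {Q : E →L[ℝ] E}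
    (hpos : ∀ t : ℝ, 0 ≤ t → ∀ x : E, 0 ≤ x → 0 ≤ NormedSpace.exp (t • Q) x)
    {N : ℝ} (hN : 0 ≤ N) {x z z' : E} (hzx : z ≤ x) (hz' : 0 ≤ z') (hz'x : z' ≤ x)
    (hp : z' ⊓ (Q x + N • x)⁺ = 0) (hxz : z' ⊓ (x - z) = 0) :
    N * ‖z'‖ ≤ ‖Q‖ * ‖z‖ := by
  set p := (Q x + N • x)⁺ with hpdef
  set q := (Q (x - z))⁻ with hqdef
  have hp0 : 0 ≤ p := posPart_nonneg _
  have hq0 : 0 ≤ q := negPart_nonneg _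
  have hq : z' ⊓ q = 0 := by
    rw [inf_comm]
    exact negPart_apply_inf_eq_zero hpos (sub_nonneg.2 hzx) hz' (by rwa [inf_comm])
  have hpq : z' ⊓ (p + q) ≤ 0 := by
    simpa [hp, hq] using inf_add_le_inf_add_inf hz' hp0 hq0
  have hpq' : (N • z') ⊓ (p + q) = 0 :=
    smul_inf_eq_zero hz' (add_nonneg hp0 hq0)
      (le_antisymm hpq (le_inf hz' (add_nonneg hp0 hq0))) hN
  have h1 : N • z' - (p + q) ≤ |Q z| := by
    refine le_trans ?_ (neg_le_abs (Q z))
    have e1 : Q x + N • x ≤ p := le_posPart _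
    have e2 : -Q (x - z) ≤ q := neg_le_negPart _
    have e3 : N • z' ≤ N • x := smul_le_smul_of_nonneg_left hz'x hN
    have e4 : N • z' - (p + q) ≤ N • x - ((Q x + N • x) + -Q (x - z)) :=
      sub_le_sub e3 (add_le_add e1 e2)
    refine e4.trans (le_of_eq ?_)
    rw [map_sub]
    abel
  have h2 : N • z' ≤ |Q z| := by
    have h3 : N • z' - (N • z') ⊓ (p + q) ≤ |Q z| := by
      rw [sub_inf, sub_self]
      exact sup_le (abs_nonneg _) h1
    rwa [hpq', sub_zero] at h3
  have h4 := norm_le_norm_of_nonneg_of_le (smul_nonneg hN hz') h2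
  rw [norm_abs_eq_norm, norm_smul, Real.norm_of_nonneg hN] at h4
  exact h4.trans (Q.le_opNorm z)

theorem apply_add_smul_nonneg [CompleteSpace E] {Q : E →L[ℝ] E}
    (hpos : ∀ t : ℝ, 0 ≤ t → ∀ x : E, 0 ≤ x → 0 ≤ NormedSpace.exp (t • Q) x)
    {N : ℝ} (hN : ‖Q‖ < N) {x : E} (hx : 0 ≤ x) : 0 ≤ Q x + N • x := by
  have hN0 : 0 < N := (norm_nonneg _).trans_lt hN
  set w := (Q x + N • x)⁻ with hwdef
  have hw : 0 ≤ w := negPart_nonneg _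
  have hiter : ∀ δ : ℝ, 0 < δ → ∀ k : ℕ,
      ‖x ⊓ δ⁻¹ • (w - (k * δ) • x)⁺‖ ≤ (‖Q‖ / N) ^ k * ‖x‖ := by
    intro δ hδ k
    have hδ' : 0 ≤ δ⁻¹ := inv_nonneg.2 hδ.le
    have hz0 : ∀ k : ℕ, 0 ≤ x ⊓ δ⁻¹ • (w - (k * δ) • x)⁺ := fun k =>
      le_inf hx (smul_nonneg hδ' (posPart_nonneg _))
    induction k with
    | zero =>
      rw [pow_zero, one_mul]
      exact norm_le_norm_of_nonneg_of_le (hz0 0) inf_le_left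
    | succ k ih =>
      have key := mul_norm_le_of_disjoint hpos hN0.le
        (z := x ⊓ δ⁻¹ • (w - (k * δ) • x)⁺) inf_le_left (hz0 (k + 1)) inf_le_left ?_ ?_
      · rw [pow_succ', mul_assoc, div_mul_eq_mul_div, le_div_iff₀ hN0, mul_comm]
        exact key.trans (mul_le_mul_of_nonneg_left ih (norm_nonneg _))
      · refine le_antisymm ?_ (le_inf (hz0 (k + 1)) (posPart_nonneg _))
        have h1 : (w - ((k + 1 : ℕ) * δ) • x)⁺ ≤ w :=
          sup_le (sub_le_self _ (smul_nonneg (by positivity) hx)) hw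
        have h2 : (δ⁻¹ • w) ⊓ (Q x + N • x)⁺ = 0 :=
          smul_inf_eq_zero hw (posPart_nonneg _)
            (by rw [inf_comm]; exact posPart_inf_negPart_eq_zero _) hδ'
        rw [← h2]
        exact inf_le_inf_right _ (inf_le_right.trans (smul_le_smul_of_nonneg_left h1 hδ'))
      · set g := w - ((k + 1 : ℕ) * δ) • x with hg
        refine le_antisymm ?_ (le_inf (hz0 (k + 1)) (sub_nonneg.2 inf_le_left))
        have h1 : x - x ⊓ δ⁻¹ • (w - (k * δ) • x)⁺ ≤ δ⁻¹ • g⁻ := by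
          rw [sub_inf, sub_self]
          refine sup_le (smul_nonneg hδ' (negPart_nonneg _)) ?_
          have e : x - δ⁻¹ • (w - (k * δ) • x) = δ⁻¹ • (-g) := by
            rw [hg, Nat.cast_succ, eq_inv_smul_iff₀ hδ.ne', smul_sub, smul_inv_smul₀ hδ.ne',
              add_mul, add_smul, one_mul]
            abel
          calc x - δ⁻¹ • (w - (k * δ) • x)⁺ ≤ x - δ⁻¹ • (w - (k * δ) • x) :=
                sub_le_sub_left (smul_le_smul_of_nonneg_left (le_posPart _) hδ') _
            _ = δ⁻¹ • (-g) := e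
            _ ≤ δ⁻¹ • g⁻ := smul_le_smul_of_nonneg_left (neg_le_negPart _) hδ'
        have h2 : (δ⁻¹ • g⁺) ⊓ (δ⁻¹ • g⁻) = 0 := by
          refine smul_inf_eq_zero (posPart_nonneg _) (smul_nonneg hδ' (negPart_nonneg _)) ?_ hδ'
          rw [inf_comm]
          refine smul_inf_eq_zero (negPart_nonneg _) (posPart_nonneg _) ?_ hδ'
          rw [inf_comm]
          exact posPart_inf_negPart_eq_zero _
        rw [← h2]
        exact inf_le_inf inf_le_right h1
  have hbound : ∀ k : ℕ, 1 ≤ k → ‖x ⊓ w‖ ≤ ((k : ℝ)⁻¹ + (‖Q‖ / N) ^ k) * ‖x‖ := by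
    intro k hk
    have hk1 : (1 : ℝ) ≤ k := by exact_mod_cast hk
    have hk0 : (0 : ℝ) < k := by linarith
    have h := hiter ((k : ℝ) ^ 2)⁻¹ (by positivity) k
    rw [inv_inv, show (k : ℝ) * ((k : ℝ) ^ 2)⁻¹ = (k : ℝ)⁻¹ by field_simp] at h
    have h1 : x ⊓ w ≤ (k : ℝ)⁻¹ • x + x ⊓ (k : ℝ) ^ 2 • (w - (k : ℝ)⁻¹ • x)⁺ := by
      rw [← sub_le_iff_le_add']
      refine le_inf ((sub_le_self _ (smul_nonneg (by positivity) hx)).trans inf_le_left) ?_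
      calc x ⊓ w - (k : ℝ)⁻¹ • x ≤ w - (k : ℝ)⁻¹ • x := sub_le_sub_right inf_le_right _
        _ ≤ (w - (k : ℝ)⁻¹ • x)⁺ := le_posPart _
        _ ≤ (k : ℝ) ^ 2 • (w - (k : ℝ)⁻¹ • x)⁺ := by
          simpa using smul_le_smul_of_nonneg_right (one_le_pow₀ hk1 : (1 : ℝ) ≤ (k : ℝ) ^ 2)
            (posPart_nonneg (w - (k : ℝ)⁻¹ • x))
    refine (norm_le_norm_of_nonneg_of_le (le_inf hx hw) h1).trans ((norm_add_le _ _).trans ?_)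
    rw [norm_smul, Real.norm_of_nonneg (by positivity), add_mul]
    gcongr
  have hlim : Tendsto (fun k : ℕ => ((k : ℝ)⁻¹ + (‖Q‖ / N) ^ k) * ‖x‖) atTop (𝓝 0) := by
    have h1 : Tendsto (fun k : ℕ => (k : ℝ)⁻¹) atTop (𝓝 0) := tendsto_inv_atTop_nhds_zero_nat
    have h2 : Tendsto (fun k : ℕ => (‖Q‖ / N) ^ k) atTop (𝓝 0) :=
      tendsto_pow_atTop_nhds_zero_of_lt_one (by positivity) ((div_lt_one hN0).2 hN)
    simpa using (h1.add h2).mul_const ‖x‖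
  have hxw : x ⊓ w = 0 := norm_le_zero_iff.1 <|
    ge_of_tendsto hlim ((eventually_ge_atTop 1).mono hbound)
  have hQw : (Q x)⁻ ⊓ w = 0 := negPart_apply_inf_eq_zero hpos hx hw hxw
  have hwQ : w ≤ (Q x)⁻ :=
    negPart_anti (le_add_of_nonneg_right (smul_nonneg hN0.le hx))
  rw [inf_eq_right.2 hwQ] at hQw
  exact negPart_eq_zero.1 hQw

end BanachLattice

/-- The Poisson weight `e^{-ct} t ^ n / n!`. -/
noncomputable def poissonWeight (c t : ℝ) (n : ℕ) : ℝ := Real.exp (-(c * t)) * (t ^ n / n.factorial)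

theorem abs_sub_mul_poissonWeight_le {c : ℝ} (hc : 0 ≤ c) {m : ℝ} (hm : 1 ≤ m) (n : ℕ) :
    |n - c * m ^ 2| * poissonWeight c (m ^ 2) n ≤
      m * Real.exp c * (poissonWeight c (m ^ 2 * Real.exp m⁻¹) n +
        poissonWeight c (m ^ 2 * Real.exp (-m⁻¹)) n) := by
  have hm0 : 0 < m := by linarith
  have hw : 0 ≤ poissonWeight c (m ^ 2) n := by unfold poissonWeight; positivity
  have hminv : m⁻¹ ≤ 1 := inv_le_one_of_one_le₀ hm
  have hminv0 : 0 < m⁻¹ := inv_pos.2 hm0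
  have tilt : ∀ κ : ℝ, |κ| ≤ 1 → m ^ 2 * κ ^ 2 = 1 →
      Real.exp (κ * (n - c * m ^ 2)) * poissonWeight c (m ^ 2) n ≤
        Real.exp c * poissonWeight c (m ^ 2 * Real.exp κ) n := by
    intro κ hκ hmκ
    have h1 : Real.exp κ - 1 - κ ≤ κ ^ 2 :=
      (le_abs_self _).trans (Real.abs_exp_sub_one_sub_id_le hκ)
    have h2 : c * m ^ 2 * (Real.exp κ - 1 - κ) ≤ c := by
      calc c * m ^ 2 * (Real.exp κ - 1 - κ) ≤ c * m ^ 2 * κ ^ 2 := by gcongr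
        _ = c := by rw [mul_assoc, hmκ, mul_one]
    have h3 : κ * (n - c * m ^ 2) + -(c * m ^ 2) ≤
        c + -(c * (m ^ 2 * Real.exp κ)) + n * κ := by linarith
    have h4 := Real.exp_le_exp.2 h3
    rw [Real.exp_add, Real.exp_add, Real.exp_add, Real.exp_nat_mul] at h4
    unfold poissonWeight
    have h5 := mul_le_mul_of_nonneg_right h4
      (by positivity : (0 : ℝ) ≤ (m ^ 2) ^ n / n.factorial)
    rw [mul_pow]
    calc _ = _ := by rw [← mul_assoc]
      _ ≤ _ := h5
      _ = _ := by ring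
  have t1 := tilt m⁻¹ (by rwa [abs_of_pos hminv0]) (by field_simp)
  have t2 := tilt (-m⁻¹) (by rwa [abs_neg, abs_of_pos hminv0]) (by field_simp)
  have habs : |(n : ℝ) - c * m ^ 2| ≤ m * (Real.exp (m⁻¹ * (n - c * m ^ 2)) +
      Real.exp (-m⁻¹ * (n - c * m ^ 2))) := by
    set y := (n : ℝ) - c * m ^ 2
    have e : y = m * (m⁻¹ * y) := by field_simp
    have h1 := Real.add_one_le_exp (m⁻¹ * y)
    have h2 := Real.add_one_le_exp (-m⁻¹ * y)
    have h3 := Real.exp_pos (m⁻¹ * y)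
    have h4 := Real.exp_pos (-m⁻¹ * y)
    rw [abs_le]
    constructor
    · nlinarith
    · nlinarith
  calc _ ≤ m * (Real.exp (m⁻¹ * (n - c * m ^ 2)) + Real.exp (-m⁻¹ * (n - c * m ^ 2))) *
        poissonWeight c (m ^ 2) n := mul_le_mul_of_nonneg_right habs hw
    _ = m * (Real.exp (m⁻¹ * (n - c * m ^ 2)) * poissonWeight c (m ^ 2) n +
        Real.exp (-m⁻¹ * (n - c * m ^ 2)) * poissonWeight c (m ^ 2) n) := by ring
    _ ≤ m * (Real.exp c * poissonWeight c (m ^ 2 * Real.exp m⁻¹) n +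
        Real.exp c * poissonWeight c (m ^ 2 * Real.exp (-m⁻¹)) n) := by gcongr
    _ = _ := by ring

section Exponential

variable {E : Type*} [NormedAddCommGroup E] [NormedSpace ℝ E] [CompleteSpace E]

theorem exp_neg_smul_mul_exp_smul (Q : E →L[ℝ] E) (t : ℝ) :
    NormedSpace.exp ((-t) • Q) * NormedSpace.exp (t • Q) = 1 := by
  let _ : NormedAlgebra ℚ (E →L[ℝ] E) := NormedAlgebra.restrictScalars ℚ ℝ _
  rw [← NormedSpace.exp_add_of_commute (((Commute.refl Q).smul_left _).smul_right _), neg_smul,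
    neg_add_cancel, NormedSpace.exp_zero]

theorem hasSum_poissonWeight_smul_pow (Q : E →L[ℝ] E) (c t : ℝ) (x : E) :
    HasSum (fun n : ℕ => poissonWeight c t n • ((Q + c • 1) ^ n) x)
      (NormedSpace.exp (t • Q) x) := by
  let _ : NormedAlgebra ℚ (E →L[ℝ] E) := NormedAlgebra.restrictScalars ℚ ℝ _
  have hexp : NormedSpace.exp (t • Q) =
      Real.exp (-(c * t)) • NormedSpace.exp (t • (Q + c • (1 : E →L[ℝ] E))) := by
    have e : t • Q = algebraMap ℝ (E →L[ℝ] E) (-(c * t)) + t • (Q + c • (1 : E →L[ℝ] E)) := by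
      rw [Algebra.algebraMap_eq_smul_one]
      module
    rw [e, NormedSpace.exp_add_of_commute (Algebra.commutes _ _),
      ← NormedSpace.algebraMap_exp_comm, ← Real.exp_eq_exp_ℝ, Algebra.algebraMap_eq_smul_one,
      smul_mul_assoc, one_mul]
  have h := NormedSpace.exp_series_hasSum_exp' (𝕂 := ℝ) (t • (Q + c • (1 : E →L[ℝ] E)))
  have h1 := (h.const_smul (Real.exp (-(c * t)))).mapL (ContinuousLinearMap.apply ℝ E x)
  rw [← hexp] at h1
  convert h1 using 1
  · ext n
    simp only [smul_pow, ContinuousLinearMap.apply_apply, smul_apply, smul_smul, poissonWeight]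
    congr 1
    ring
  · rfl

theorem hasSum_sub_mul_poissonWeight_smul_pow (Q : E →L[ℝ] E) (c t : ℝ) (x : E) :
    HasSum (fun n : ℕ => ((n - c * t) * poissonWeight c t n) • ((Q + c • 1) ^ n) x)
      (t • Q (NormedSpace.exp (t • Q) x)) := by
  have h := hasSum_poissonWeight_smul_pow Q c t x
  have h1 : HasSum (fun n : ℕ => (n * poissonWeight c t n) • ((Q + c • 1) ^ n) x)
      (t • (Q + c • 1) (NormedSpace.exp (t • Q) x)) := by
    have h2 := (t • (Q + c • (1 : E →L[ℝ] E))).hasSum h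
    have hterm : ∀ n : ℕ, (t • (Q + c • (1 : E →L[ℝ] E)))
        (poissonWeight c t n • ((Q + c • (1 : E →L[ℝ] E)) ^ n) x) =
        (((n + 1 : ℕ) : ℝ) * poissonWeight c t (n + 1)) •
          ((Q + c • (1 : E →L[ℝ] E)) ^ (n + 1)) x := by
      intro n
      have hcoef : ((n + 1 : ℕ) : ℝ) * poissonWeight c t (n + 1) = t * poissonWeight c t n := by
        unfold poissonWeight
        rw [Nat.factorial_succ, pow_succ]
        push_cast
        field_simp
      rw [hcoef, smul_apply, map_smul, smul_smul, pow_succ', mul_apply_eq_comp]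
    simp only [hterm] at h2
    have h3 := (hasSum_nat_add_iff (f := fun n : ℕ =>
      (n * poissonWeight c t n) • ((Q + c • (1 : E →L[ℝ] E)) ^ n) x) 1).1 h2
    simpa using h3
  have h4 := h1.sub (h.const_smul (c * t))
  convert h4 using 1
  · ext n
    rw [smul_smul, ← sub_smul, sub_mul]
  · simp only [add_apply, smul_apply, one_apply_eq_self]
    module

end Exponential

section BanachLattice

variable {E : Type*} [NormedAddCommGroup E] [Lattice E] [HasSolidNorm E] [IsOrderedAddMonoid E]
  [NormedSpace ℝ E] [IsOrderedModule ℝ E]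

theorem abs_smul_apply_exp_le [CompleteSpace E] {Q : E →L[ℝ] E} {c : ℝ} (hc : 0 ≤ c)
    (hQ : ∀ x : E, 0 ≤ x → 0 ≤ Q x + c • x) {m : ℝ} (hm : 1 ≤ m) {x : E} (hx : 0 ≤ x) :
    |m ^ 2 • Q (NormedSpace.exp (m ^ 2 • Q) x)| ≤
      (m * Real.exp c) • (NormedSpace.exp ((m ^ 2 * Real.exp m⁻¹) • Q) x +
        NormedSpace.exp ((m ^ 2 * Real.exp (-m⁻¹)) • Q) x) := by
  have hP : ∀ n : ℕ, 0 ≤ ((Q + c • (1 : E →L[ℝ] E)) ^ n) x := by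
    intro n
    induction n with
    | zero => simpa using hx
    | succ n ih =>
      rw [pow_succ']
      exact hQ _ ih
  have h0 := hasSum_sub_mul_poissonWeight_smul_pow Q c (m ^ 2) x
  have h1 := ((hasSum_poissonWeight_smul_pow Q c (m ^ 2 * Real.exp m⁻¹) x).add
    (hasSum_poissonWeight_smul_pow Q c (m ^ 2 * Real.exp (-m⁻¹)) x)).const_smul (m * Real.exp c)
  have hw : 0 ≤ poissonWeight c (m ^ 2) := fun n => by
    unfold poissonWeight; simp only [Pi.zero_apply]; positivity
  have hle := fun n => abs_sub_mul_poissonWeight_le hc hm n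
  rw [abs_le']
  constructor
  · refine hasSum_le (fun n => ?_) h0 h1
    rw [← add_smul, smul_smul]
    refine smul_le_smul_of_nonneg_right (le_trans ?_ (hle n)) (hP n)
    exact mul_le_mul_of_nonneg_right (le_abs_self _) (hw n)
  · refine hasSum_le (fun n => ?_) h0.neg h1
    rw [← add_smul, smul_smul, ← neg_smul, ← neg_mul]
    refine smul_le_smul_of_nonneg_right (le_trans ?_ (hle n)) (hP n)
    exact mul_le_mul_of_nonneg_right (neg_le_abs _) (hw n)

end BanachLattice

/-- If a bounded linear operator `Q` on a real Banach lattice `E` generates a uniformly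
bounded group `(e^{tQ})_{t ∈ ℝ}` of operators which are positive for `t ≥ 0`, then `Q = 0`. -/
theorem generator_of_bounded_positive_group_is_zero
    (E : Type*) [NormedAddCommGroup E] [Lattice E] [HasSolidNorm E] [IsOrderedAddMonoid E]
    [NormedSpace ℝ E] [IsOrderedModule ℝ E]
    [CompleteSpace E] (Q : E →L[ℝ] E)
    (hbdd : ∃ M : ℝ, ∀ t : ℝ, ‖NormedSpace.exp (t • Q)‖ ≤ M)
    (hpos : ∀ t : ℝ, 0 ≤ t → ∀ x : E, 0 ≤ x → 0 ≤ NormedSpace.exp (t • Q) x) :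
    Q = 0 := by
  obtain ⟨M, hM⟩ := hbdd
  have hM0 : 0 ≤ M := (norm_nonneg _).trans (hM 0)
  set c := ‖Q‖ + 1 with hcdef
  have hc : 0 ≤ c := by positivity
  have hQ : ∀ x : E, 0 ≤ x → 0 ≤ Q x + c • x := fun x hx =>
    apply_add_smul_nonneg hpos (lt_add_one _) hx
  have hMx : ∀ (t : ℝ) (x : E), ‖NormedSpace.exp (t • Q) x‖ ≤ M * ‖x‖ := fun t x =>
    ContinuousLinearMap.le_of_opNorm_le _ (hM t) x
  have hnonneg : ∀ x : E, 0 ≤ x → Q x = 0 := by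
    intro x hx
    have hbound : ∀ m : ℕ, 1 ≤ m → ‖Q x‖ ≤ (M * (Real.exp c * (2 * (M * ‖x‖)))) * (m : ℝ)⁻¹ := by
      intro m hm
      have hm1 : (1 : ℝ) ≤ m := by exact_mod_cast hm
      have hm0 : (0 : ℝ) < m := by linarith
      have h1 := norm_le_norm_of_nonneg_of_le (abs_nonneg _) (abs_smul_apply_exp_le hc hQ hm1 hx)
      rw [norm_abs_eq_norm, norm_smul _ (_ + _), Real.norm_of_nonneg (by positivity)] at h1
      have h2 := h1.trans (mul_le_mul_of_nonneg_left ((norm_add_le _ _).trans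
        (add_le_add (hMx _ x) (hMx _ x))) (by positivity))
      have hcomm : Commute Q (NormedSpace.exp ((m : ℝ) ^ 2 • Q)) :=
        ((Commute.refl Q).smul_right _).exp_right
      have h3 : NormedSpace.exp ((-(m : ℝ) ^ 2) • Q)
          ((m : ℝ) ^ 2 • Q (NormedSpace.exp ((m : ℝ) ^ 2 • Q) x)) = (m : ℝ) ^ 2 • Q x := by
        have e1 : Q (NormedSpace.exp ((m : ℝ) ^ 2 • Q) x) =
            NormedSpace.exp ((m : ℝ) ^ 2 • Q) (Q x) := DFunLike.congr_fun hcomm.eq x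
        have e2 : NormedSpace.exp ((-(m : ℝ) ^ 2) • Q) (NormedSpace.exp ((m : ℝ) ^ 2 • Q) (Q x)) =
            Q x := DFunLike.congr_fun (exp_neg_smul_mul_exp_smul Q ((m : ℝ) ^ 2)) (Q x)
        rw [map_smul, e1, e2]
      have h4 := hMx (-(m : ℝ) ^ 2) ((m : ℝ) ^ 2 • Q (NormedSpace.exp ((m : ℝ) ^ 2 • Q) x))
      rw [h3] at h4
      have h5 := h4.trans (mul_le_mul_of_nonneg_left h2 hM0)
      rw [norm_smul, Real.norm_of_nonneg (by positivity)] at h5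
      rw [← div_eq_mul_inv, le_div_iff₀ hm0]
      refine le_of_mul_le_mul_left ?_ hm0
      calc (m : ℝ) * (‖Q x‖ * m) = (m : ℝ) ^ 2 * ‖Q x‖ := by ring
        _ ≤ _ := h5
        _ = _ := by ring
    have hlim := (tendsto_inv_atTop_nhds_zero_nat (𝕜 := ℝ)).const_mul
      (M * (Real.exp c * (2 * (M * ‖x‖))))
    rw [mul_zero] at hlim
    exact norm_le_zero_iff.1 (ge_of_tendsto hlim ((eventually_ge_atTop 1).mono hbound))
  ext x
  rw [← posPart_sub_negPart x, map_sub, hnonneg _ (posPart_nonneg x),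
    hnonneg _ (negPart_nonneg x), sub_zero, zero_apply]
end
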